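/- For every ε > 0 there exist δ > 0 and N such that for every n ≥ N, every orgraph Γ on n vertices with at most δ·C(n,4) induced C⃗4's and such that the underlying graph of Γ has at most δ·C(n,3) induced copies of P̄₃ (3-element vertex sets spanning exactly one edge) satisfies: the number of edges of FDF(Γ) is at least (4/9 − ε)·C(n,3). -/

import Mathlib

open Finset

/-- `E` is an orgraph relation: no loops and no pair of opposite edges. -/
def IsOrgraph {V : Type*} (E : V → V → Prop) : Prop :=
  (∀ v, ¬ E v v) ∧ ∀ v w, E v w → ¬ E w v

/-- `E` contains an induced (oriented) 4-cycle: four distinct vertices whose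
induced sub-orgraph has edge set exactly the oriented cycle. -/
def HasInducedC4 {V : Type*} (E : V → V → Prop) : Prop :=
  ∃ v₁ v₂ v₃ v₄ : V,
    v₁ ≠ v₂ ∧ v₁ ≠ v₃ ∧ v₁ ≠ v₄ ∧ v₂ ≠ v₃ ∧ v₂ ≠ v₄ ∧ v₃ ≠ v₄ ∧
    E v₁ v₂ ∧ E v₂ v₃ ∧ E v₃ v₄ ∧ E v₄ v₁ ∧
    ¬ E v₂ v₁ ∧ ¬ E v₃ v₂ ∧ ¬ E v₄ v₃ ∧ ¬ E v₁ v₄ ∧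
    ¬ E v₁ v₃ ∧ ¬ E v₃ v₁ ∧ ¬ E v₂ v₄ ∧ ¬ E v₄ v₂

/-- The triple `{u,v,w}` spans an edge of `FDF(Γ)`: within the triple, some
vertex has out-degree 2, or some vertex has in-degree 0 and out-degree 0. -/
def FDFedge {V : Type*} (E : V → V → Prop) (u v w : V) : Prop :=
  (E u v ∧ E u w) ∨ (E v u ∧ E v w) ∨ (E w u ∧ E w v) ∨
  (¬ E u v ∧ ¬ E v u ∧ ¬ E u w ∧ ¬ E w u) ∨
  (¬ E v u ∧ ¬ E u v ∧ ¬ E v w ∧ ¬ E w v) ∨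
  (¬ E w u ∧ ¬ E u w ∧ ¬ E w v ∧ ¬ E v w)

-- The number of edges of the 3-graph `FDF(Γ)`. 
open Classical in
noncomputable def fdfCount (V : Type*) [Fintype V] (E : V → V → Prop) : ℕ :=
  ((Finset.univ.powersetCard 3).filter (fun s : Finset V =>
    ∃ u v w : V, u ≠ v ∧ u ≠ w ∧ v ≠ w ∧ s = {u, v, w} ∧ FDFedge E u v w)).card

-- The number of edges of the undirected graph underlying the orgraph `E`. 
open Classical in
noncomputable def underlyingEdgeCount (V : Type*) [Fintype V] (E : V → V → Prop) : ℕ :=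
  ((Finset.univ.powersetCard 2).filter (fun s : Finset V =>
    ∃ u v : V, u ≠ v ∧ s = {u, v} ∧ (E u v ∨ E v u))).card

-- The number of 4-sets of vertices spanning an induced C⃗₄ in the orgraph E. 
open Classical in
noncomputable def c4Count (V : Type*) [Fintype V] (E : V → V → Prop) : ℕ :=
  ((Finset.univ.powersetCard 4).filter (fun s : Finset V =>
    ∃ v₁ v₂ v₃ v₄ : V,
      v₁ ≠ v₂ ∧ v₁ ≠ v₃ ∧ v₁ ≠ v₄ ∧ v₂ ≠ v₃ ∧ v₂ ≠ v₄ ∧ v₃ ≠ v₄ ∧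
      s = {v₁, v₂, v₃, v₄} ∧
      E v₁ v₂ ∧ E v₂ v₃ ∧ E v₃ v₄ ∧ E v₄ v₁ ∧
      ¬ E v₂ v₁ ∧ ¬ E v₃ v₂ ∧ ¬ E v₄ v₃ ∧ ¬ E v₁ v₄ ∧
      ¬ E v₁ v₃ ∧ ¬ E v₃ v₁ ∧ ¬ E v₂ v₄ ∧ ¬ E v₄ v₂)).card

-- The number of induced copies of P̄₃ (3-sets spanning exactly one edge) in
--the underlying graph of the orgraph E. 
open Classical in
noncomputable def p3barCount (V : Type*) [Fintype V] (E : V → V → Prop) : ℕ :=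
  ((Finset.univ.powersetCard 3).filter (fun s : Finset V =>
    ∃ u v w : V, u ≠ v ∧ u ≠ w ∧ v ≠ w ∧ s = {u, v, w} ∧
      (E u v ∨ E v u) ∧ ¬ (E u w ∨ E w u) ∧ ¬ (E v w ∨ E w v))).card


theorem rl_three (a b c : ℝ) (hab : b ≤ a) (hbc : c ≤ b) (hc : 0 ≤ c) (h1 : a + b + c = 1) :
    4/9 ≤ 3*(a*b+b*c+c*a)^2 + a^3+b^3+c^3 + 16/9*(a*b-c^2)^3 := by
  -- κ = 1/3 - c, η = κ² - (a-1/3)(b-1/3)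
  obtain ⟨k, hk⟩ : ∃ k, k = 1/3 - c := ⟨_, rfl⟩
  obtain ⟨p, hp⟩ : ∃ p, p = (a-1/3)*(b-1/3) := ⟨_, rfl⟩
  have hk0 : 0 ≤ k := by linarith
  have hk1 : k ≤ 1/3 := by linarith
  have hpk : p ≤ k^2/4 := by
    subst hp hk
    nlinarith [sq_nonneg (a-b)]
  have ha : a = 1 - b - c := by linarith
  have e1 : 3*(a*b+b*c+c*a)^2 + a^3+b^3+c^3 + 16/9*(a*b-c^2)^3 - 4/9
      = 3*(k^2-p)^2 - 3*k*p + 16/9*(k-(k^2-p))^3 := by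
    subst hp hk ha; ring
  have hg : 0 ≤ k - (k^2-p) := by
    have : k - (k^2-p) = a*b - c^2 := by subst hp hk ha; ring
    rw [this]; nlinarith
  obtain ⟨q, hq⟩ : ∃ q, q = k^2/4 - p := ⟨_, rfl⟩
  have hq0 : 0 ≤ q := by linarith
  have hp' : p = k^2/4 - q := by linarith
  subst hp'
  have hmain : 0 ≤ 3*(k^2-(k^2/4 - q))^2 - 3*k*(k^2/4 - q) + 16/9*(k-(k^2-(k^2/4 - q)))^3 := by
    by_cases hq1 : k^2/4 ≤ q
    · have := pow_nonneg hg 3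
      nlinarith [mul_nonneg hk0 (sub_nonneg.2 hq1), sq_nonneg (k^2-(k^2/4 - q))]
    · push Not at hq1
      -- g = k - 3/4 k^2 - q ≥ k - k^2 ≥ 2k/3
      have hgl : k*(1-k) ≤ k-(k^2-(k^2/4 - q)) := by nlinarith
      have hkk : 0 ≤ k*(1-k) := by nlinarith
      have h3 : (k*(1-k))^3 ≤ (k-(k^2-(k^2/4 - q)))^3 := by gcongr
      have h4 : 3*k*q ≥ 0 := by positivity
      have hk3 : 0 ≤ k^3 := by positivity
      have h5 : (3/4*k^2)^2 ≤ (k^2-(k^2/4 - q))^2 := by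
        apply pow_le_pow_left₀ (by positivity); linarith
      have h6 : 0 ≤ 16/9*(1-k)^3 + 27/16*k - 3/4 := by
        nlinarith [mul_nonneg hk0 (sub_nonneg.2 hk1), mul_nonneg (mul_nonneg hk0 hk0) (sub_nonneg.2 hk1)]
      have h7 := mul_nonneg hk3 h6
      nlinarith
  linarith

theorem rl_main (a b c r D W G : ℝ) (hab : b ≤ a) (hb : 0 ≤ b) (hc : 0 ≤ c) (h1 : a + b + c = 1)
    (hr : 0 ≤ r) (hrb : r ≤ b * c) (hrc : r ≤ c * c) (hD : 2 * D = 1 - a^2 - b^2 - r)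
    (hW : 0 ≤ W) (hWr : r^2 ≤ W * c) (hG : 0 ≤ G) (hG' : c ≤ D → 16/9*(D-c)^3 ≤ G) :
    4/9 ≤ 3*D^2 + a^3 + b^3 + W + G := by
  obtain ⟨t, ht0, ht, htb, htc, hWt⟩ : ∃ t, 0 ≤ t ∧ r = c * t ∧ t ≤ b ∧ t ≤ c ∧ c * t^2 ≤ W := by
    rcases hc.eq_or_lt with h | h
    · subst h
      exact ⟨0, le_refl _, by linarith, hb, le_refl _, by linarith⟩
    · refine ⟨r / c, by positivity, by field_simp, ?_, ?_, ?_⟩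
      · rw [div_le_iff₀ h]; exact hrb
      · rw [div_le_iff₀ h]; exact hrc
      · rw [div_pow, mul_div_assoc', div_le_iff₀ (by positivity)]
        nlinarith
  have hcc : c = 1 - a - b := by linarith
  rcases le_total c b with hcb | hcb
  · have key := rl_three a b c hab hcb hc h1
    have hD0 : a*b+b*c+c*a = D - c*(c-t)/2 := by
      subst ht hcc; nlinarith
    have hq : 0 ≤ c*(c-t) := mul_nonneg hc (by linarith)
    have hle : a*b+b*c+c*a ≤ D := by linarith
    have hge : c ≤ a*b+b*c+c*a := by
      have : a*b+b*c+c*a = c + (a*b - c^2) := by subst hcc; ring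
      have : 0 ≤ a*b - c^2 := by nlinarith
      linarith
    have hcc2 : a*b - c^2 = (a*b+b*c+c*a) - c := by subst hcc; ring
    have hg0 : (a*b - c^2)^3 ≤ (D-c)^3 := by
      rw [hcc2]; apply pow_le_pow_left₀ <;> linarith
    have hG2 := hG' (by linarith)
    obtain ⟨D0, hD0'⟩ : ∃ D0, D0 = a*b+b*c+c*a := ⟨_, rfl⟩
    rw [← hD0'] at key hD0 hle hge
    have hlow : 2*c ≤ 3*D0 := by linarith
    have : 3*D0^2 + c^3 ≤ 3*D^2 + c*t^2 := by
      have e : 3*D^2 + c*t^2 - (3*D0^2 + c^3) = c*(c-t)*(3/2*(D+D0) - (t+c)) := by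
        rw [hD0]; ring
      have : 0 ≤ c*(c-t)*(3/2*(D+D0) - (t+c)) := mul_nonneg hq (by linarith)
      linarith
    linarith
  · have hcub : 3*D^2 + a^3 + b^3 + c*t^2 ≤ 3*D^2 + a^3 + b^3 + W + G := by linarith
    refine le_trans ?_ hcub
    rcases le_total a (1/3) with ha | ha
    · obtain ⟨s, hs⟩ : ∃ s, s = a^2 + b^2 + c*t := ⟨_, rfl⟩
      have ha0 : 0 ≤ a := by linarith
      have hs3 : s ≤ 1/3 := by rw [hs]; nlinarith
      have hs2 : s^2 ≤ a^3 + b^3 + c*t^2 := by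
        have e : a^3 + b^3 + c*t^2 - 2*s*(a^2+b^2+c*t) + s^2*(a+b+c)
          = a*(a-s)^2 + b*(b-s)^2 + c*(t-s)^2 := by ring
        have : 0 ≤ a*(a-s)^2 + b*(b-s)^2 + c*(t-s)^2 := by positivity
        rw [h1, ← hs] at e
        nlinarith
      have hD2 : D = (1-s)/2 := by rw [hs]; linarith
      have hs4 : 0 ≤ (1-3*s)*(11-21*s) := mul_nonneg (by linarith) (by linarith)
      rw [hD2]; linarith
    · obtain ⟨D1, hD1⟩ : ∃ D1, D1 = (1-a^2-b*(1-a))/2 := ⟨_, rfl⟩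
      obtain ⟨D2, hD2⟩ : ∃ D2, D2 = (1-a^2-(1-a)/2*(1-a))/2 := ⟨_, rfl⟩
      have hba : 2*b ≤ 1 - a := by linarith
      have ha1 : a ≤ 1 := by linarith
      have hD2l : 1-a ≤ 3*D2 := by rw [hD2]; nlinarith
      have hD12 : D1 = D2 + (1-a)*((1-a)/2-b)/2 := by rw [hD1, hD2]; ring
      have hq2 : 0 ≤ (1-a)*((1-a)/2-b) := mul_nonneg (by linarith) (by linarith)
      have hDD : D = D1 + c*(b-t)/2 := by rw [hD1]; subst ht hcc; linarith
      have hq1 : 0 ≤ c*(b-t) := mul_nonneg hc (by linarith)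
      have s1 : 3*D1^2 + c*b^2 ≤ 3*D^2 + c*t^2 := by
        have e : 3*D^2 + c*t^2 - (3*D1^2 + c*b^2) = c*(b-t)*(3/2*(D+D1) - (t+b)) := by
          rw [hDD]; ring
        have : 0 ≤ c*(b-t)*(3/2*(D+D1) - (t+b)) := mul_nonneg hq1 (by linarith)
        linarith
      have s2 : 3*D2^2 + (1-a)*((1-a)/2)^2 ≤ 3*D1^2 + (1-a)*b^2 := by
        have e : 3*D1^2 + (1-a)*b^2 - (3*D2^2 + (1-a)*((1-a)/2)^2)
            = (1-a)*((1-a)/2-b)*(3/2*(D1+D2) - ((1-a)/2+b)) := by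
          rw [hD12]; ring
        have : 0 ≤ (1-a)*((1-a)/2-b)*(3/2*(D1+D2) - ((1-a)/2+b)) := mul_nonneg hq2 (by linarith)
        linarith
      have s3 : (1-a)*b^2 = b^3 + c*b^2 := by rw [hcc]; ring
      have s4 : 4/9 ≤ 3*D2^2 + (1-a)*((1-a)/2)^2 + a^3 := by
        have e : 3*D2^2 + (1-a)*((1-a)/2)^2 + a^3 - 4/9
            = 3*(3/4*(a-1/3)^2)^2 + 3/4*(a-1/3)^3 := by rw [hD2]; ring
        have : 0 ≤ (a-1/3)^3 := pow_nonneg (by linarith) 3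
        have : 0 ≤ 3*(3/4*(a-1/3)^2)^2 := by positivity
        linarith
      linarith

section comb
open Classical

theorem exists_sink {V : Type*} (E : V → V → Prop) (hor : IsOrgraph E) (hC : ¬ HasInducedC4 E)
    (A B : Finset V) (hAB : ∀ x ∈ A, ∀ y ∈ B, E x y ∨ E y x)
    (hA : ∀ x ∈ A, ∀ x' ∈ A, ¬ E x x') (hB : ∀ x ∈ B, ∀ x' ∈ B, ¬ E x x')
    (hAn : A.Nonempty) :
    (∃ x ∈ A, ∀ y ∈ B, E y x) ∨ (∃ y ∈ B, ∀ x ∈ A, E x y) := by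
  obtain ⟨x, hx, hmax⟩ := A.exists_max_image (fun x => (B.filter (fun y => E y x)).card) hAn
  by_cases h : ∀ y ∈ B, E y x
  · exact Or.inl ⟨x, hx, h⟩
  right
  push Not at h
  obtain ⟨y, hy, hyx⟩ := h
  refine ⟨y, hy, fun x' hx' => ?_⟩
  by_contra hx'y
  have hyx' : E y x' := (hAB x' hx' y hy).resolve_left hx'y
  have hxy : E x y := (hAB x hx y hy).resolve_right hyx
  have : ∃ y' ∈ B, E y' x ∧ ¬ E y' x' := by
    by_contra hcon
    push Not at hcon
    have hss : B.filter (fun y => E y x) ⊂ B.filter (fun y => E y x') := by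
      rw [Finset.ssubset_iff_of_subset]
      · exact ⟨y, by simp [hy, hyx'], by simp [hyx]⟩
      · intro z hz
        simp only [Finset.mem_filter] at hz ⊢
        exact ⟨hz.1, hcon z hz.1 hz.2⟩
    have := Finset.card_lt_card hss
    have := hmax x' hx'
    omega
  obtain ⟨y', hy', h1, h2⟩ := this
  have hx'y' : E x' y' := (hAB x' hx' y' hy').resolve_right h2
  apply hC
  refine ⟨x, y, x', y', ?_, ?_, ?_, ?_, ?_, ?_, hxy, hyx', hx'y', h1, hyx, hx'y, h2, hor.2 _ _ h1,
    hA _ hx _ hx', hA _ hx' _ hx, hB _ hy _ hy', hB _ hy' _ hy⟩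
  · rintro rfl; exact hor.1 _ hxy
  · rintro rfl; exact hyx hyx'
  · rintro rfl; exact hor.1 _ h1
  · rintro rfl; exact hor.1 _ hyx'
  · rintro rfl; exact hyx h1
  · rintro rfl; exact hor.1 _ hx'y'

theorem nested_sum {V : Type*} (E : V → V → Prop) (hor : IsOrgraph E) (hC : ¬ HasInducedC4 E)
    (t t' : ℝ) (ht : 0 ≤ t) (ht' : 0 ≤ t') (k : ℕ) :
    ∀ A B : Finset V, A.card + B.card = k → (∀ x ∈ A, ∀ y ∈ B, E x y ∨ E y x) →
    (∀ x ∈ A, ∀ x' ∈ A, ¬ E x x') → (∀ x ∈ B, ∀ x' ∈ B, ¬ E x x') →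
    max ((A.card : ℝ) - t') 0 * max ((B.card : ℝ) - t) 0 ≤
      ∑ x ∈ A, max (((B.filter (fun y => E y x)).card : ℝ) - t) 0 +
      ∑ y ∈ B, max (((A.filter (fun x => E x y)).card : ℝ) - t') 0 := by
  induction k with
  | zero =>
    intro A B hk _ _ _
    have hA : A.card = 0 := by omega
    have : max ((A.card : ℝ) - t') 0 = 0 := by simp [hA, ht']
    rw [this, zero_mul]
    exact add_nonneg (Finset.sum_nonneg fun _ _ => le_max_right _ _)
      (Finset.sum_nonneg fun _ _ => le_max_right _ _)
  | succ k ih =>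
    intro A B hk hAB hA hB
    rcases A.eq_empty_or_nonempty with hAe | hAn
    · have : max ((A.card : ℝ) - t') 0 = 0 := by simp [hAe, ht']
      rw [this, zero_mul]
      exact add_nonneg (Finset.sum_nonneg fun _ _ => le_max_right _ _)
        (Finset.sum_nonneg fun _ _ => le_max_right _ _)
    rcases exists_sink E hor hC A B hAB hA hB hAn with ⟨x, hx, hsink⟩ | ⟨y, hy, hsink⟩
    · have hcard := Finset.card_erase_add_one hx
      have := ih (A.erase x) B (by omega) (fun z hz => hAB z (Finset.mem_of_mem_erase hz))
        (fun z hz w hw => hA z (Finset.mem_of_mem_erase hz) w (Finset.mem_of_mem_erase hw)) hB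
      rw [← Finset.add_sum_erase A _ hx]
      have e1 : B.filter (fun y => E y x) = B := Finset.filter_true_of_mem hsink
      have e2 : ∀ y ∈ B, (A.erase x).filter (fun x => E x y) = A.filter (fun x => E x y) := by
        intro y hy
        rw [Finset.filter_erase, Finset.erase_eq_of_notMem]
        simp only [Finset.mem_filter, not_and]
        intro _
        exact hor.2 _ _ (hsink y hy)
      have e3 : ∑ y ∈ B, max ((((A.erase x).filter (fun x => E x y)).card : ℝ) - t') 0
          = ∑ y ∈ B, max (((A.filter (fun x => E x y)).card : ℝ) - t') 0 :=
        Finset.sum_congr rfl fun y hy => by rw [e2 y hy]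
      rw [e3] at this
      rw [e1]
      have hc : (A.card : ℝ) = (A.erase x).card + 1 := by exact_mod_cast hcard.symm
      have hm : max ((A.card : ℝ) - t') 0 ≤ max (((A.erase x).card : ℝ) - t') 0 + 1 := by
        rw [hc]
        apply max_le
        · have := le_max_left (((A.erase x).card : ℝ) - t') 0; linarith
        · have := le_max_right (((A.erase x).card : ℝ) - t') 0; linarith
      have hm2 := mul_le_mul_of_nonneg_right hm (le_max_right ((B.card : ℝ) - t) 0)
      linarith
    · have hcard := Finset.card_erase_add_one hy
      have := ih A (B.erase y) (by omega) (fun z hz w hw => hAB z hz w (Finset.mem_of_mem_erase hw)) hA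
        (fun z hz w hw => hB z (Finset.mem_of_mem_erase hz) w (Finset.mem_of_mem_erase hw))
      rw [← Finset.add_sum_erase B _ hy]
      have e1 : A.filter (fun x => E x y) = A := Finset.filter_true_of_mem hsink
      have e2 : ∀ x ∈ A, (B.erase y).filter (fun y => E y x) = B.filter (fun y => E y x) := by
        intro x hx
        rw [Finset.filter_erase, Finset.erase_eq_of_notMem]
        simp only [Finset.mem_filter, not_and]
        intro _
        exact hor.2 _ _ (hsink x hx)
      have e3 : ∑ x ∈ A, max ((((B.erase y).filter (fun y => E y x)).card : ℝ) - t) 0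
          = ∑ x ∈ A, max (((B.filter (fun y => E y x)).card : ℝ) - t) 0 :=
        Finset.sum_congr rfl fun x hx => by rw [e2 x hx]
      rw [e3] at this
      rw [e1]
      have hc : (B.card : ℝ) = (B.erase y).card + 1 := by exact_mod_cast hcard.symm
      have hm : max ((B.card : ℝ) - t) 0 ≤ max (((B.erase y).card : ℝ) - t) 0 + 1 := by
        rw [hc]
        apply max_le
        · have := le_max_left (((B.erase y).card : ℝ) - t) 0; linarith
        · have := le_max_right (((B.erase y).card : ℝ) - t) 0; linarith
      have hm2 := mul_le_mul_of_nonneg_left hm (le_max_right ((A.card : ℝ) - t') 0)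
      linarith

/-- out-neighbourhood -/
noncomputable def outN {V : Type*} [Fintype V] (E : V → V → Prop) (v : V) : Finset V :=
  Finset.univ.filter (fun w => E v w)

/-- non-neighbourhood, including the vertex itself -/
noncomputable def nonN {V : Type*} [Fintype V] (E : V → V → Prop) (v : V) : Finset V :=
  Finset.univ.filter (fun w => ¬ E v w ∧ ¬ E w v)

noncomputable def Qf {V : Type*} [Fintype V] (E : V → V → Prop) : ℝ :=
  3 * ∑ v, ((outN E v).card : ℝ)^2 + ∑ v, ((nonN E v).card : ℝ)^2

theorem sum_out {V : Type*} [Fintype V] (E : V → V → Prop) (hor : IsOrgraph E) :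
    2 * ∑ v, ((outN E v).card : ℝ) + ∑ v, ((nonN E v).card : ℝ) = (Fintype.card V : ℝ)^2 := by
  have h1 : ∀ v : V, ((outN E v).card : ℝ) = ∑ w, if E v w then (1:ℝ) else 0 := by
    intro v; simp [outN]
  have h2 : ∀ v : V, ((nonN E v).card : ℝ) = ∑ w, if ¬ E v w ∧ ¬ E w v then (1:ℝ) else 0 := by
    intro v; rw [nonN, Finset.card_filter]; push_cast; rfl
  have h3 : ∑ v, ((outN E v).card : ℝ) = ∑ v, ∑ w, if E w v then (1:ℝ) else 0 := by
    simp_rw [h1]; exact Finset.sum_comm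
  have h4 : ∑ v, ((outN E v).card : ℝ) = ∑ v, ∑ w, if E v w then (1:ℝ) else 0 := by
    simp_rw [h1]
  rw [two_mul]
  nth_rewrite 1 [h3]
  rw [h4]
  simp_rw [h2, ← Finset.sum_add_distrib]
  have : ∀ v w : V, ((if E w v then (1:ℝ) else 0) + if E v w then (1:ℝ) else 0) +
      (if ¬ E v w ∧ ¬ E w v then (1:ℝ) else 0) = 1 := by
    intro v w
    have := hor.2 v w
    by_cases h : E v w <;> by_cases h' : E w v <;> simp_all
  simp_rw [this]
  simp [sq]

theorem rl_scaled (n a b c r D W X : ℝ) (hn0 : 0 < n) (hab : b ≤ a) (hb0 : 0 ≤ b) (hc0 : 0 ≤ c)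
    (habc : a + b + c = n) (hr0 : 0 ≤ r) (hrb : r ≤ b * c) (hrc : r ≤ c * c)
    (hDe : 2 * (D * n) = n^2 - a^2 - b^2 - r) (hW0 : 0 ≤ W) (hWr : r^2 ≤ W * c) (hX0 : 0 ≤ X)
    (hXlow : c ≤ D → 16/27*(D-c)^3 ≤ X) :
    4/9 * n^3 ≤ 3*(n*D^2 + X) + (a^3 + b^3 + W) := by
  have key := rl_main (a/n) (b/n) (c/n) (r/n^2) (D/n) (W/n^3) (3*X/n^3) (by gcongr) (by positivity)
    (by positivity) (by rw [← add_div, ← add_div, habc]; field_simp) (by positivity)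
    (by rw [div_mul_div_comm, ← sq]; gcongr) (by rw [div_mul_div_comm, ← sq n]; gcongr)
    (by
      have : D/n = D*n/n^2 := by field_simp
      rw [this, mul_div_assoc', hDe]; field_simp) (by positivity)
    (by
      rw [div_pow, div_mul_div_comm]
      have : (n^2)^2 = n^3*n := by ring
      rw [this]; gcongr) (by positivity)
    (by
      intro h
      have h' : c ≤ D := by rwa [div_le_div_iff_of_pos_right hn0] at h
      have := hXlow h'
      rw [← sub_div, div_pow, mul_div_assoc']
      exact div_le_div_of_nonneg_right (by linarith) (by positivity))
  have e : 3 * (D / n) ^ 2 + (a / n) ^ 3 + (b / n) ^ 3 + W / n ^ 3 + 3 * X / n ^ 3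
      = (3*(n*D^2 + X) + (a^3 + b^3 + W)) / n^3 := by field_simp; ring
  rw [e, le_div_iff₀ (by positivity)] at key
  exact key

set_option maxHeartbeats 2000000 in
theorem exact_bound {V : Type*} [Fintype V] (E : V → V → Prop) (hor : IsOrgraph E)
    (hC : ¬ HasInducedC4 E)
    (hP : ∀ u v w, ¬ E u v → ¬ E v u → ¬ E v w → ¬ E w v → ¬ E u w ∧ ¬ E w u) :
    4/9 * (Fintype.card V : ℝ)^3 ≤ Qf E := by
  rcases isEmpty_or_nonempty V with hV | hV
  · simp [Qf]
  obtain ⟨n, hn⟩ : ∃ n : ℝ, n = Fintype.card V := ⟨_, rfl⟩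
  have hn0 : 0 < n := by rw [hn]; exact_mod_cast Fintype.card_pos
  have hmem : ∀ v w, w ∈ nonN E v ↔ ¬ E v w ∧ ¬ E w v := by intro v w; simp [nonN]
  have hself : ∀ v, v ∈ nonN E v := fun v => by simp [hmem, hor.1 v]
  have hcls : ∀ v w, w ∈ nonN E v → nonN E w = nonN E v := by
    intro v w hw
    rw [hmem] at hw
    ext z
    rw [hmem, hmem]
    constructor
    · rintro ⟨h1, h2⟩; exact hP v w z hw.1 hw.2 h1 h2
    · rintro ⟨h1, h2⟩; exact hP w v z hw.2 hw.1 h1 h2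
  have hindep : ∀ v, ∀ x ∈ nonN E v, ∀ x' ∈ nonN E v, ¬ E x x' := by
    intro v x hx x' hx' h
    rw [hmem] at hx hx'
    exact (hP x v x' hx.2 hx.1 hx'.1 hx'.2).1 h
  obtain ⟨v0, -, hv0⟩ := (Finset.univ : Finset V).exists_max_image (fun v => (nonN E v).card)
    Finset.univ_nonempty
  obtain ⟨A, hAdef⟩ : ∃ A, A = nonN E v0 := ⟨_, rfl⟩
  have hAind : ∀ x ∈ A, ∀ x' ∈ A, ¬ E x x' := by rw [hAdef]; exact hindep v0
  have hAcl : ∀ v ∈ A, nonN E v = A := by rw [hAdef]; exact fun v hv => hcls v0 v hv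
  have hAmax : ∀ v, (nonN E v).card ≤ A.card := by
    rw [hAdef]; exact fun v => hv0 v (Finset.mem_univ _)
  -- B, possibly empty
  obtain ⟨B, hBA, hBcl, hBmax, hBind, hBadj⟩ : ∃ B : Finset V, Disjoint A B ∧
      (∀ v ∈ B, nonN E v = B) ∧ (∀ v, v ∉ A → (nonN E v).card ≤ B.card) ∧
      (∀ x ∈ B, ∀ x' ∈ B, ¬ E x x') ∧ (∀ x ∈ A, ∀ y ∈ B, E x y ∨ E y x) ∧ B.card ≤ A.card := by
    by_cases hAu : (Finset.univ \ A).Nonempty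
    · obtain ⟨v1, hv1, hmax⟩ := (Finset.univ \ A).exists_max_image (fun v => (nonN E v).card) hAu
      have hv1A : v1 ∉ A := by simpa using hv1
      have hdisj : ∀ x ∈ A, ∀ y ∈ nonN E v1, E x y ∨ E y x := by
        intro x hx y hy
        by_contra hcon
        push Not at hcon
        have h1 := hAcl x hx
        have h2 := hcls v1 y hy
        have h3 := hcls x y ((hmem _ _).2 hcon)
        apply hv1A
        rw [← h1, ← h3, h2]
        exact hself v1
      refine ⟨nonN E v1, ?_, fun v hv => hcls v1 v hv, ?_, hindep v1, hdisj, hAmax v1⟩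
      · rw [Finset.disjoint_left]
        intro x hx hx'
        rcases hdisj x hx x hx' with h | h <;> exact hor.1 _ h
      · intro v hv
        exact hmax v (by simpa using hv)
    · refine ⟨∅, by simp, by simp, ?_, by simp, by simp, by simp⟩
      intro v hv
      exact absurd ⟨v, by simpa using hv⟩ hAu
  obtain ⟨hBadj, hBle⟩ := hBadj
  obtain ⟨R, hR⟩ : ∃ R : Finset V, R = Finset.univ \ (A ∪ B) := ⟨_, rfl⟩
  have hsplit : ∀ F : V → ℝ, ∑ v, F v = ∑ v ∈ A, F v + ∑ v ∈ B, F v + ∑ v ∈ R, F v := by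
    intro F
    rw [hR, ← Finset.sum_union hBA, add_comm, Finset.sum_sdiff (Finset.subset_univ _)]
  obtain ⟨a, ha⟩ : ∃ a : ℝ, a = A.card := ⟨_, rfl⟩
  obtain ⟨b, hb⟩ : ∃ b : ℝ, b = B.card := ⟨_, rfl⟩
  obtain ⟨c, hc⟩ : ∃ c : ℝ, c = R.card := ⟨_, rfl⟩
  have hb0 : 0 ≤ b := by rw [hb]; exact Nat.cast_nonneg _
  have hc0 : 0 ≤ c := by rw [hc]; exact Nat.cast_nonneg _
  have hab : b ≤ a := by rw [ha, hb]; exact_mod_cast hBle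
  have habc : a + b + c = n := by
    have := hsplit (fun _ => 1)
    simp at this
    rw [hn, this, ha, hb, hc]
  have hRb : ∀ v ∈ R, ((nonN E v).card : ℝ) ≤ b := by
    intro v hv
    rw [hb]
    have : v ∉ A := by
      rw [hR] at hv; simp at hv; exact hv.1
    exact_mod_cast hBmax v this
  have hRc : ∀ v ∈ R, ((nonN E v).card : ℝ) ≤ c := by
    intro v hv
    rw [hc]
    have hvn : v ∉ A ∧ v ∉ B := by
      rw [hR] at hv; simpa using hv
    have : nonN E v ⊆ R := by
      intro w hw
      rw [hR]
      simp only [Finset.mem_sdiff, Finset.mem_univ, true_and, Finset.mem_union, not_or]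
      have h1 := hcls v w hw
      constructor
      · intro hwA
        rw [hAcl w hwA] at h1
        exact hvn.1 (h1 ▸ hself v)
      · intro hwB
        rw [hBcl w hwB] at h1
        exact hvn.2 (h1 ▸ hself v)
    exact_mod_cast Finset.card_le_card this
  obtain ⟨r, hr⟩ : ∃ r : ℝ, r = ∑ v ∈ R, ((nonN E v).card : ℝ) := ⟨_, rfl⟩
  obtain ⟨W, hW⟩ : ∃ W : ℝ, W = ∑ v ∈ R, ((nonN E v).card : ℝ)^2 := ⟨_, rfl⟩
  have hr0 : 0 ≤ r := by rw [hr]; exact Finset.sum_nonneg fun _ _ => Nat.cast_nonneg _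
  have hW0 : 0 ≤ W := by rw [hW]; exact Finset.sum_nonneg fun _ _ => sq_nonneg _
  have hrb : r ≤ b * c := by
    rw [hr, hc, mul_comm, ← nsmul_eq_mul]
    exact Finset.sum_le_card_nsmul _ _ _ hRb
  have hrc : r ≤ c * c := by
    rw [hr]; nth_rewrite 1 [hc]; rw [← nsmul_eq_mul]
    exact Finset.sum_le_card_nsmul _ _ _ hRc
  have hWr : r^2 ≤ W * c := by
    have := sq_sum_le_card_mul_sum_sq (s := R) (f := fun v => ((nonN E v).card : ℝ))
    rw [hr, hW, hc, mul_comm]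
    exact this
  have hS : ∑ v, ((nonN E v).card : ℝ) = a^2 + b^2 + r := by
    rw [hsplit, ← hr]
    congr 2
    · rw [Finset.sum_congr rfl (fun v hv => by rw [hAcl v hv]), Finset.sum_const, ← ha]
      rw [nsmul_eq_mul, ← ha, sq]
    · rw [Finset.sum_congr rfl (fun v hv => by rw [hBcl v hv]), Finset.sum_const, ← hb]
      rw [nsmul_eq_mul, ← hb, sq]
  have hS2 : ∑ v, ((nonN E v).card : ℝ)^2 = a^3 + b^3 + W := by
    rw [hsplit, ← hW]
    congr 2
    · rw [Finset.sum_congr rfl (fun v hv => by rw [hAcl v hv]), Finset.sum_const, ← ha]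
      rw [nsmul_eq_mul, ← ha]; ring
    · rw [Finset.sum_congr rfl (fun v hv => by rw [hBcl v hv]), Finset.sum_const, ← hb]
      rw [nsmul_eq_mul, ← hb]; ring
  -- mean
  obtain ⟨D, hD⟩ : ∃ D : ℝ, D = (∑ v, ((outN E v).card : ℝ)) / n := ⟨_, rfl⟩
  have hDn : ∑ v, ((outN E v).card : ℝ) = D * n := by
    rw [hD, div_mul_cancel₀ _ hn0.ne']
  have hDe : 2 * (D * n) = n^2 - a^2 - b^2 - r := by
    have := sum_out E hor
    rw [hDn, hS, ← hn] at this; linarith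
  have hvar : ∑ v, ((outN E v).card : ℝ)^2
      = n * D^2 + ∑ v, (((outN E v).card : ℝ) - D)^2 := by
    have : ∀ v : V, (((outN E v).card : ℝ) - D)^2
        = ((outN E v).card : ℝ)^2 - 2*D*((outN E v).card : ℝ) + D^2 := fun v => by ring
    simp_rw [this]
    rw [Finset.sum_add_distrib, Finset.sum_sub_distrib, ← Finset.mul_sum, hDn]
    simp only [Finset.sum_const, Finset.card_univ, nsmul_eq_mul]
    rw [← hn]; ring
  obtain ⟨X, hX⟩ : ∃ X : ℝ, X = ∑ v, (((outN E v).card : ℝ) - D)^2 := ⟨_, rfl⟩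
  have hX0 : 0 ≤ X := by rw [hX]; exact Finset.sum_nonneg fun _ _ => sq_nonneg _
  have hXlow : c ≤ D → 16/27*(D-c)^3 ≤ X := by
    intro hcD
    obtain ⟨u, hu⟩ : ∃ u : ℝ, u = D - c := ⟨_, rfl⟩
    have hu0 : 0 ≤ u := by linarith
    have hua : u ≤ b := by
      -- D ≤ n - a
      have : D * n ≤ (n - a) * n := by nlinarith
      have := le_of_mul_le_mul_right this hn0
      linarith
    have hns := nested_sum E hor hC (b - 2/3*u) (a - 2/3*u) (by linarith) (by linarith) _ A B rfl
      hBadj hAind hBind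
    rw [← ha, ← hb, show a - (a - 2/3*u) = 2/3*u by ring, show b - (b - 2/3*u) = 2/3*u by ring,
      max_eq_left (by linarith)] at hns
    have hpt : ∀ z : ℝ, ∀ y : ℝ, y ≤ D - z → 4/3*u * max (y - u/3) 0 ≤ (z - D)^2 := by
      intro z y hy
      rcases le_total (y - u/3) 0 with h | h
      · rw [max_eq_right h]; nlinarith [sq_nonneg (z-D)]
      · rw [max_eq_left h]
        have : y^2 ≤ (D-z)^2 := by apply pow_le_pow_left₀ <;> linarith
        nlinarith [sq_nonneg (y - 2/3*u)]
    have hAs : 4/3*u * ∑ x ∈ A, max (((B.filter (fun y => E y x)).card : ℝ) - (b - 2/3*u)) 0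
        ≤ ∑ v ∈ A, (((outN E v).card : ℝ) - D)^2 := by
      rw [Finset.mul_sum]
      apply Finset.sum_le_sum
      intro x hx
      have hout : outN E x ⊆ (B \ B.filter (fun y => E y x)) ∪ R := by
        intro y hy
        have hy' : E x y := by simpa [outN] using hy
        simp only [Finset.mem_union, Finset.mem_sdiff, Finset.mem_filter, not_and, hR,
          Finset.mem_univ, true_and, not_or]
        by_cases hyB : y ∈ B
        · exact Or.inl ⟨hyB, fun _ => hor.2 _ _ hy'⟩
        · exact Or.inr ⟨fun hyA => hAind x hx y hyA hy', hyB⟩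
      have h1 := (Finset.card_le_card hout).trans (Finset.card_union_le _ _)
      rw [Finset.card_sdiff_of_subset (Finset.filter_subset _ _)] at h1
      have h2 : (B.filter (fun y => E y x)).card ≤ B.card := Finset.card_filter_le _ _
      have h3 : (outN E x).card + (B.filter (fun y => E y x)).card ≤ B.card + R.card := by omega
      have h4 : ((outN E x).card : ℝ) + ((B.filter (fun y => E y x)).card : ℝ) ≤ b + c := by
        rw [hb, hc]; exact_mod_cast h3
      have := hpt (outN E x).card (((B.filter (fun y => E y x)).card : ℝ) - b + u) (by linarith)
      rw [show ((B.filter (fun y => E y x)).card : ℝ) - b + u - u/3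
        = ((B.filter (fun y => E y x)).card : ℝ) - (b - 2/3*u) by ring] at this
      exact this
    have hBs : 4/3*u * ∑ x ∈ B, max (((A.filter (fun y => E y x)).card : ℝ) - (a - 2/3*u)) 0
        ≤ ∑ v ∈ B, (((outN E v).card : ℝ) - D)^2 := by
      rw [Finset.mul_sum]
      apply Finset.sum_le_sum
      intro x hx
      have hout : outN E x ⊆ (A \ A.filter (fun y => E y x)) ∪ R := by
        intro y hy
        have hy' : E x y := by simpa [outN] using hy
        simp only [Finset.mem_union, Finset.mem_sdiff, Finset.mem_filter, not_and, hR,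
          Finset.mem_univ, true_and, not_or]
        by_cases hyA : y ∈ A
        · exact Or.inl ⟨hyA, fun _ => hor.2 _ _ hy'⟩
        · exact Or.inr ⟨hyA, fun hyB => hBind x hx y hyB hy'⟩
      have h1 := (Finset.card_le_card hout).trans (Finset.card_union_le _ _)
      rw [Finset.card_sdiff_of_subset (Finset.filter_subset _ _)] at h1
      have h2 : (A.filter (fun y => E y x)).card ≤ A.card := Finset.card_filter_le _ _
      have h3 : (outN E x).card + (A.filter (fun y => E y x)).card ≤ A.card + R.card := by omega
      have h4 : ((outN E x).card : ℝ) + ((A.filter (fun y => E y x)).card : ℝ) ≤ a + c := by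
        rw [ha, hc]; exact_mod_cast h3
      have := hpt (outN E x).card (((A.filter (fun y => E y x)).card : ℝ) - a + u) (by linarith)
      rw [show ((A.filter (fun y => E y x)).card : ℝ) - a + u - u/3
        = ((A.filter (fun y => E y x)).card : ℝ) - (a - 2/3*u) by ring] at this
      exact this
    have hRs : 0 ≤ ∑ v ∈ R, (((outN E v).card : ℝ) - D)^2 :=
      Finset.sum_nonneg fun _ _ => sq_nonneg _
    have hXs := hsplit (fun v => (((outN E v).card : ℝ) - D)^2)
    rw [← hX] at hXs
    have := mul_le_mul_of_nonneg_left hns (show 0 ≤ 4/3*u by linarith)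
    rw [← hu]
    nlinarith
  have hQ : Qf E = 3*(n*D^2 + X) + (a^3 + b^3 + W) := by
    rw [Qf, hS2, hvar, ← hX]
  rw [hQ, ← hn]
  exact rl_scaled n a b c r D W X hn0 hab hb0 hc0 habc hr0 hrb hrc hDe hW0 hWr hX0 hXlow

end comb

section sampling
open Classical

theorem sum_comp_inj {κ ι α : Type*} [Fintype κ] [Fintype ι] [Fintype α]
    [DecidableEq κ] [DecidableEq ι]
    (e : κ → ι) (he : Function.Injective e) (G : (κ → α) → ℝ) :
    (Fintype.card α : ℝ)^(Fintype.card κ) * ∑ φ : ι → α, G (φ ∘ e)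
      = (Fintype.card α : ℝ)^(Fintype.card ι) * ∑ ψ : κ → α, G ψ := by
  let σ : κ ⊕ ↥(Set.range e)ᶜ ≃ ι :=
    (Equiv.sumCongr (Equiv.ofInjective e he) (Equiv.refl _)).trans (Equiv.Set.sumCompl _)
  have hσ : ∀ x, σ (Sum.inl x) = e x := fun x => by simp [σ]
  have h1 : ∑ φ : ι → α, G (φ ∘ e) = ∑ χ : (κ → α) × (↥(Set.range e)ᶜ → α), G χ.1 := by
    refine Fintype.sum_equiv
      ((Equiv.arrowCongr σ.symm (Equiv.refl α)).trans (Equiv.sumArrowEquivProdArrow _ _ _)) _ _ ?_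
    intro φ
    congr 1
  rw [h1, Fintype.sum_prod_type]
  have hcard : Fintype.card ι = Fintype.card κ + Fintype.card ↥(Set.range e)ᶜ := by
    rw [← Fintype.card_sum]; exact (Fintype.card_congr σ).symm
  simp only [Finset.sum_const, Finset.card_univ, Fintype.card_fun, nsmul_eq_mul]
  rw [← Finset.mul_sum, hcard, pow_add]
  push_cast
  ring

theorem sum_fin_succ {α : Type*} [Fintype α] (k : ℕ) (G : (Fin (k+1) → α) → ℝ) :
    ∑ ψ : Fin (k+1) → α, G ψ = ∑ x, ∑ ψ : Fin k → α, G (Fin.cons x ψ) := by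
  rw [← Fintype.sum_prod_type']
  exact (Fintype.sum_equiv (Fin.consEquiv (fun _ => α)) _ _ (fun _ => rfl)).symm

theorem sum3 {m : ℕ} {α : Type*} [Fintype α] (i j k : Fin m) (hij : i ≠ j) (hik : i ≠ k)
    (hjk : j ≠ k) (g : α → α → α → ℝ) :
    (Fintype.card α : ℝ)^3 * ∑ φ : Fin m → α, g (φ i) (φ j) (φ k)
      = (Fintype.card α : ℝ)^m * ∑ u, ∑ v, ∑ w, g u v w := by
  have he : Function.Injective ![i, j, k] := by
    intro x y hxy
    fin_cases x <;> fin_cases y <;> simp_all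
  have := sum_comp_inj ![i, j, k] he (fun ψ : Fin 3 → α => g (ψ 0) (ψ 1) (ψ 2))
  simp only [Fintype.card_fin] at this
  have h : ∑ ψ : Fin 3 → α, g (ψ 0) (ψ 1) (ψ 2) = ∑ u, ∑ v, ∑ w, g u v w := by
    rw [sum_fin_succ 2]
    refine Finset.sum_congr rfl fun u _ => ?_
    rw [sum_fin_succ 1]
    refine Finset.sum_congr rfl fun v _ => ?_
    rw [sum_fin_succ 0]
    refine Finset.sum_congr rfl fun w _ => ?_
    rw [Fintype.sum_unique]
    rfl
  exact this.trans (congrArg (fun t => (Fintype.card α : ℝ)^m * t) h)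

theorem sum4 {m : ℕ} {α : Type*} [Fintype α] (i j k l : Fin m) (hij : i ≠ j) (hik : i ≠ k)
    (hil : i ≠ l) (hjk : j ≠ k) (hjl : j ≠ l) (hkl : k ≠ l) (g : α → α → α → α → ℝ) :
    (Fintype.card α : ℝ)^4 * ∑ φ : Fin m → α, g (φ i) (φ j) (φ k) (φ l)
      = (Fintype.card α : ℝ)^m * ∑ u, ∑ v, ∑ w, ∑ z, g u v w z := by
  have he : Function.Injective ![i, j, k, l] := by
    intro x y hxy
    fin_cases x <;> fin_cases y <;> simp_all
  have := sum_comp_inj ![i, j, k, l] he (fun ψ : Fin 4 → α => g (ψ 0) (ψ 1) (ψ 2) (ψ 3))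
  simp only [Fintype.card_fin] at this
  have h : ∑ ψ : Fin 4 → α, g (ψ 0) (ψ 1) (ψ 2) (ψ 3) = ∑ u, ∑ v, ∑ w, ∑ z, g u v w z := by
    rw [sum_fin_succ 3]
    refine Finset.sum_congr rfl fun u _ => ?_
    rw [sum_fin_succ 2]
    refine Finset.sum_congr rfl fun v _ => ?_
    rw [sum_fin_succ 1]
    refine Finset.sum_congr rfl fun w _ => ?_
    rw [sum_fin_succ 0]
    refine Finset.sum_congr rfl fun z _ => ?_
    rw [Fintype.sum_unique]
    rfl
  exact this.trans (congrArg (fun t => (Fintype.card α : ℝ)^m * t) h)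

noncomputable def qf {V : Type*} (E : V → V → Prop) (u v w : V) : ℝ :=
  3 * (if E u v ∧ E u w then 1 else 0) +
    (if (¬ E u v ∧ ¬ E v u) ∧ (¬ E u w ∧ ¬ E w u) then 1 else 0)

theorem Qf_eq {V : Type*} [Fintype V] (E : V → V → Prop) :
    Qf E = ∑ u, ∑ v, ∑ w, qf E u v w := by
  have h : ∀ P : V → Prop, ((Finset.univ.filter P).card : ℝ)^2
      = ∑ v, ∑ w, if P v ∧ P w then (1:ℝ) else 0 := by
    intro P
    rw [Finset.card_filter]
    push_cast
    rw [sq, Finset.sum_mul_sum]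
    refine Finset.sum_congr rfl fun v _ => Finset.sum_congr rfl fun w _ => ?_
    by_cases h1 : P v <;> by_cases h2 : P w <;> simp [h1, h2]
  unfold Qf outN nonN qf
  rw [Finset.mul_sum, ← Finset.sum_add_distrib]
  refine Finset.sum_congr rfl fun u _ => ?_
  have h1 := h (fun w => E u w)
  have h2 := h (fun w => ¬ E u w ∧ ¬ E w u)
  simp only [Finset.sum_add_distrib, ← Finset.mul_sum]
  congr 1
  · rw [← h1]
  · convert h2

def bad3 {V : Type*} (E : V → V → Prop) (u v w : V) : Prop :=
  ¬ E u v ∧ ¬ E v u ∧ ¬ E v w ∧ ¬ E w v ∧ (E u w ∨ E w u)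

def bad4 {V : Type*} (E : V → V → Prop) (v₁ v₂ v₃ v₄ : V) : Prop :=
  v₁ ≠ v₂ ∧ v₁ ≠ v₃ ∧ v₁ ≠ v₄ ∧ v₂ ≠ v₃ ∧ v₂ ≠ v₄ ∧ v₃ ≠ v₄ ∧
    E v₁ v₂ ∧ E v₂ v₃ ∧ E v₃ v₄ ∧ E v₄ v₁ ∧
    ¬ E v₂ v₁ ∧ ¬ E v₃ v₂ ∧ ¬ E v₄ v₃ ∧ ¬ E v₁ v₄ ∧
    ¬ E v₁ v₃ ∧ ¬ E v₃ v₁ ∧ ¬ E v₂ v₄ ∧ ¬ E v₄ v₂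

theorem bad3_ne {V : Type*} {E : V → V → Prop} (hor : IsOrgraph E) {u v w : V}
    (h : bad3 E u v w) : u ≠ v ∧ u ≠ w ∧ v ≠ w := by
  obtain ⟨h1, h2, h3, h4, h5⟩ := h
  refine ⟨?_, ?_, ?_⟩
  · rintro rfl; exact h5.elim h3 h4
  · rintro rfl; exact h5.elim (hor.1 _) (hor.1 _)
  · rintro rfl; exact h5.elim h1 h2

noncomputable def B3 {V : Type*} [Fintype V] (E : V → V → Prop) : ℝ :=
  ∑ u, ∑ v, ∑ w, if bad3 E u v w then (1:ℝ) else 0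

noncomputable def B4 {V : Type*} [Fintype V] (E : V → V → Prop) : ℝ :=
  ∑ u, ∑ v, ∑ w, ∑ z, if bad4 E u v w z then (1:ℝ) else 0

theorem le_sum3 {ι : Type*} [Fintype ι] (f : ι → ι → ι → ℝ) (hf : ∀ i j k, 0 ≤ f i j k)
    (i j k : ι) : f i j k ≤ ∑ i, ∑ j, ∑ k, f i j k :=
  calc f i j k ≤ ∑ k, f i j k :=
        Finset.single_le_sum (f := fun k => f i j k) (fun _ _ => hf _ _ _) (Finset.mem_univ k)
    _ ≤ ∑ j, ∑ k, f i j k :=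
        Finset.single_le_sum (f := fun j => ∑ k, f i j k)
          (fun _ _ => Finset.sum_nonneg fun _ _ => hf _ _ _) (Finset.mem_univ j)
    _ ≤ _ := Finset.single_le_sum (f := fun i => ∑ j, ∑ k, f i j k)
          (fun _ _ => Finset.sum_nonneg fun _ _ => Finset.sum_nonneg fun _ _ => hf _ _ _)
          (Finset.mem_univ i)

theorem le_sum4 {ι : Type*} [Fintype ι] (f : ι → ι → ι → ι → ℝ) (hf : ∀ i j k l, 0 ≤ f i j k l)
    (i j k l : ι) : f i j k l ≤ ∑ i, ∑ j, ∑ k, ∑ l, f i j k l :=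
  calc f i j k l ≤ ∑ j, ∑ k, ∑ l, f i j k l := le_sum3 _ (hf i) j k l
    _ ≤ _ := Finset.single_le_sum (f := fun i => ∑ j, ∑ k, ∑ l, f i j k l)
          (fun _ _ => Finset.sum_nonneg fun _ _ => Finset.sum_nonneg fun _ _ =>
            Finset.sum_nonneg fun _ _ => hf _ _ _ _)
          (Finset.mem_univ i)

theorem pull_bound {V : Type*} (E : V → V → Prop) (hor : IsOrgraph E) (m : ℕ) (φ : Fin m → V) :
    4/9 * (m:ℝ)^3 * (1 - (∑ i, ∑ j, ∑ k, if bad3 E (φ i) (φ j) (φ k) then (1:ℝ) else 0)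
      - (∑ i, ∑ j, ∑ k, ∑ l, if bad4 E (φ i) (φ j) (φ k) (φ l) then (1:ℝ) else 0))
      ≤ ∑ i, ∑ j, ∑ k, qf E (φ i) (φ j) (φ k) := by
  have h30 : 0 ≤ ∑ i, ∑ j, ∑ k, if bad3 E (φ i) (φ j) (φ k) then (1:ℝ) else 0 :=
    Finset.sum_nonneg fun _ _ => Finset.sum_nonneg fun _ _ => Finset.sum_nonneg fun _ _ => by
      split_ifs <;> norm_num
  have h40 : 0 ≤ ∑ i, ∑ j, ∑ k, ∑ l, if bad4 E (φ i) (φ j) (φ k) (φ l) then (1:ℝ) else 0 :=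
    Finset.sum_nonneg fun _ _ => Finset.sum_nonneg fun _ _ => Finset.sum_nonneg fun _ _ =>
      Finset.sum_nonneg fun _ _ => by split_ifs <;> norm_num
  have hq0 : 0 ≤ ∑ i, ∑ j, ∑ k, qf E (φ i) (φ j) (φ k) :=
    Finset.sum_nonneg fun _ _ => Finset.sum_nonneg fun _ _ => Finset.sum_nonneg fun _ _ => by
      unfold qf; split_ifs <;> norm_num
  have hm : 0 ≤ 4/9 * (m:ℝ)^3 := by positivity
  by_cases hb3 : ∃ i j k, bad3 E (φ i) (φ j) (φ k)
  · obtain ⟨i, j, k, h⟩ := hb3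
    have := le_sum3 (fun i j k => if bad3 E (φ i) (φ j) (φ k) then (1:ℝ) else 0)
      (fun _ _ _ => by split_ifs <;> norm_num) i j k
    simp only [h, if_true] at this
    exact (mul_nonpos_of_nonneg_of_nonpos hm (by linarith)).trans hq0
  by_cases hb4 : ∃ i j k l, bad4 E (φ i) (φ j) (φ k) (φ l)
  · obtain ⟨i, j, k, l, h⟩ := hb4
    have := le_sum4 (fun i j k l => if bad4 E (φ i) (φ j) (φ k) (φ l) then (1:ℝ) else 0)
      (fun _ _ _ _ => by split_ifs <;> norm_num) i j k l
    simp only [h, if_true] at this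
    exact (mul_nonpos_of_nonneg_of_nonpos hm (by linarith)).trans hq0
  have := exact_bound (fun i j => E (φ i) (φ j)) ⟨fun v => hor.1 _, fun v w => hor.2 _ _⟩
    (by
      rintro ⟨i, j, k, l, h⟩
      apply hb4
      obtain ⟨-, -, -, -, -, -, h1, h2, h3, h4, h5, h6, h7, h8, h9, h10, h11, h12⟩ := h
      refine ⟨i, j, k, l, ?_, ?_, ?_, ?_, ?_, ?_, h1, h2, h3, h4, h5, h6, h7, h8, h9, h10, h11, h12⟩
      · intro h; rw [h] at h1; exact hor.1 _ h1
      · intro h; rw [h] at h1; exact h6 h1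
      · intro h; rw [h] at h4; exact hor.1 _ h4
      · intro h; rw [h] at h2; exact hor.1 _ h2
      · intro h; rw [h] at h1; exact h8 h1
      · intro h; rw [h] at h3; exact hor.1 _ h3)
    (by
      intro u v w h1 h2 h3 h4
      by_contra hcon
      exact hb3 ⟨u, v, w, h1, h2, h3, h4, by tauto⟩)
  rw [Qf_eq, Fintype.card_fin] at this
  calc _ ≤ 4/9 * (m:ℝ)^3 * 1 := mul_le_mul_of_nonneg_left (by linarith) hm
    _ ≤ _ := by rw [mul_one]; exact this

theorem sum_eq_ind (m : ℕ) :
    (∑ i : Fin m, ∑ j : Fin m, ∑ k : Fin m,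
      ((if i = j then (1:ℝ) else 0) + (if i = k then 1 else 0) + (if j = k then 1 else 0)))
      = 3 * (m:ℝ)^2 := by
  simp [Finset.sum_add_distrib]
  ring

theorem sampling_bound {V : Type*} [Fintype V] [Nonempty V] (E : V → V → Prop) (hor : IsOrgraph E)
    (m : ℕ) :
    4/9 * (m:ℝ)^3 * (1 - (m:ℝ)^3 * (B3 E / (Fintype.card V : ℝ)^3)
      - (m:ℝ)^4 * (B4 E / (Fintype.card V : ℝ)^4))
      ≤ (m:ℝ)^3 * (Qf E / (Fintype.card V : ℝ)^3) + 9 * (m:ℝ)^2 := by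
  obtain ⟨N, hN⟩ : ∃ N : ℝ, N = Fintype.card V := ⟨_, rfl⟩
  have hN0 : 0 < N := by rw [hN]; exact_mod_cast Fintype.card_pos
  rw [← hN]
  have hsum := Finset.sum_le_sum (s := Finset.univ) fun (φ : Fin m → V) _ => pull_bound E hor m φ
  rw [← Finset.mul_sum, Finset.sum_sub_distrib, Finset.sum_sub_distrib] at hsum
  have hone : ∑ φ : Fin m → V, (1:ℝ) = N^m := by
    simp [hN]
  rw [hone] at hsum
  -- bad triples
  have h3 : ∑ φ : Fin m → V, (∑ i, ∑ j, ∑ k, if bad3 E (φ i) (φ j) (φ k) then (1:ℝ) else 0)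
      ≤ N^m * ((m:ℝ)^3 * (B3 E / N^3)) := by
    have hb : ∀ i j k : Fin m, ∑ φ : Fin m → V, (if bad3 E (φ i) (φ j) (φ k) then (1:ℝ) else 0)
        ≤ N^m * (B3 E / N^3) := by
      intro i j k
      have hB : 0 ≤ B3 E := Finset.sum_nonneg fun _ _ => Finset.sum_nonneg fun _ _ =>
        Finset.sum_nonneg fun _ _ => by split_ifs <;> norm_num
      by_cases hd : i ≠ j ∧ i ≠ k ∧ j ≠ k
      · have := sum3 i j k hd.1 hd.2.1 hd.2.2 (fun u v w => if bad3 E u v w then (1:ℝ) else 0)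
        rw [← hN] at this
        rw [mul_div_assoc', le_div_iff₀ (by positivity), mul_comm, this]
        rfl
      · rw [Finset.sum_eq_zero]
        · positivity
        · intro φ _
          rw [if_neg]
          intro h
          have := bad3_ne hor h
          exact hd ⟨fun h => this.1 (by rw [h]), fun h => this.2.1 (by rw [h]),
            fun h => this.2.2 (by rw [h])⟩
    rw [Finset.sum_comm]
    calc _ = ∑ i, ∑ j, ∑ k, ∑ φ : Fin m → V, (if bad3 E (φ i) (φ j) (φ k) then (1:ℝ) else 0) := by
          refine Finset.sum_congr rfl fun i _ => ?_
          rw [Finset.sum_comm]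
          refine Finset.sum_congr rfl fun j _ => ?_
          rw [Finset.sum_comm]
      _ ≤ ∑ i : Fin m, ∑ j : Fin m, ∑ k : Fin m, N^m * (B3 E / N^3) :=
          Finset.sum_le_sum fun i _ => Finset.sum_le_sum fun j _ => Finset.sum_le_sum fun k _ =>
            hb i j k
      _ = _ := by
          simp only [Finset.sum_const, Finset.card_univ, Fintype.card_fin, nsmul_eq_mul]; ring
  have h4 : ∑ φ : Fin m → V, (∑ i, ∑ j, ∑ k, ∑ l,
      if bad4 E (φ i) (φ j) (φ k) (φ l) then (1:ℝ) else 0)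
      ≤ N^m * ((m:ℝ)^4 * (B4 E / N^4)) := by
    have hb : ∀ i j k l : Fin m,
        ∑ φ : Fin m → V, (if bad4 E (φ i) (φ j) (φ k) (φ l) then (1:ℝ) else 0)
        ≤ N^m * (B4 E / N^4) := by
      intro i j k l
      have hB : 0 ≤ B4 E := Finset.sum_nonneg fun _ _ => Finset.sum_nonneg fun _ _ =>
        Finset.sum_nonneg fun _ _ => Finset.sum_nonneg fun _ _ => by split_ifs <;> norm_num
      by_cases hd : i ≠ j ∧ i ≠ k ∧ i ≠ l ∧ j ≠ k ∧ j ≠ l ∧ k ≠ l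
      · obtain ⟨d1, d2, d3, d4, d5, d6⟩ := hd
        have := sum4 i j k l d1 d2 d3 d4 d5 d6
          (fun u v w z => if bad4 E u v w z then (1:ℝ) else 0)
        rw [← hN] at this
        rw [mul_div_assoc', le_div_iff₀ (by positivity), mul_comm, this]
        rfl
      · rw [Finset.sum_eq_zero]
        · positivity
        · intro φ _
          rw [if_neg]
          rintro ⟨g1, g2, g3, g4, g5, g6, -⟩
          exact hd ⟨fun h => g1 (by rw [h]), fun h => g2 (by rw [h]), fun h => g3 (by rw [h]),
            fun h => g4 (by rw [h]), fun h => g5 (by rw [h]), fun h => g6 (by rw [h])⟩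
    rw [Finset.sum_comm]
    calc _ = ∑ i, ∑ j, ∑ k, ∑ l, ∑ φ : Fin m → V,
            (if bad4 E (φ i) (φ j) (φ k) (φ l) then (1:ℝ) else 0) := by
          refine Finset.sum_congr rfl fun i _ => ?_
          rw [Finset.sum_comm]
          refine Finset.sum_congr rfl fun j _ => ?_
          rw [Finset.sum_comm]
          refine Finset.sum_congr rfl fun k _ => ?_
          rw [Finset.sum_comm]
      _ ≤ ∑ i : Fin m, ∑ j : Fin m, ∑ k : Fin m, ∑ l : Fin m, N^m * (B4 E / N^4) :=
          Finset.sum_le_sum fun i _ => Finset.sum_le_sum fun j _ => Finset.sum_le_sum fun k _ =>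
            Finset.sum_le_sum fun l _ => hb i j k l
      _ = _ := by
          simp only [Finset.sum_const, Finset.card_univ, Fintype.card_fin, nsmul_eq_mul]; ring
  have hq : ∑ φ : Fin m → V, (∑ i, ∑ j, ∑ k, qf E (φ i) (φ j) (φ k))
      ≤ N^m * ((m:ℝ)^3 * (Qf E / N^3) + 9 * (m:ℝ)^2) := by
    have hQ0 : 0 ≤ Qf E := by
      unfold Qf
      exact add_nonneg (mul_nonneg (by norm_num) (Finset.sum_nonneg fun _ _ => sq_nonneg _))
        (Finset.sum_nonneg fun _ _ => sq_nonneg _)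
    have hb : ∀ i j k : Fin m, ∑ φ : Fin m → V, qf E (φ i) (φ j) (φ k)
        ≤ N^m * (Qf E / N^3) + 3 * N^m * ((if i = j then (1:ℝ) else 0) + (if i = k then 1 else 0)
          + (if j = k then 1 else 0)) := by
      intro i j k
      by_cases hd : i ≠ j ∧ i ≠ k ∧ j ≠ k
      · have := sum3 i j k hd.1 hd.2.1 hd.2.2 (qf E)
        rw [← hN, ← Qf_eq] at this
        simp only [hd.1, hd.2.1, hd.2.2, if_false, add_zero, mul_zero]
        rw [mul_div_assoc', le_div_iff₀ (by positivity), mul_comm, this]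
      · have h1 : ∑ φ : Fin m → V, qf E (φ i) (φ j) (φ k) ≤ ∑ φ : Fin m → V, 3 * (1:ℝ) := by
          apply Finset.sum_le_sum
          intro φ _
          unfold qf
          split_ifs with h h'
          · exact absurd h.1 h'.1.1
          all_goals norm_num
        rw [← Finset.mul_sum, hone] at h1
        have h2 : (1:ℝ) ≤ (if i = j then (1:ℝ) else 0) + (if i = k then 1 else 0)
          + (if j = k then 1 else 0) := by
          have e0 : ∀ (p : Prop) [Decidable p], (0:ℝ) ≤ if p then (1:ℝ) else 0 := fun p _ => by
            split_ifs <;> norm_num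
          have e1 := e0 (i = j)
          have e2 := e0 (i = k)
          have e3 := e0 (j = k)
          by_cases c1 : i = j
          · rw [if_pos c1]; linarith
          by_cases c2 : i = k
          · rw [if_pos c2]; linarith
          by_cases c3 : j = k
          · rw [if_pos c3]; linarith
          exact absurd ⟨c1, c2, c3⟩ hd
        have h3 : 0 ≤ N^m * (Qf E / N^3) := by positivity
        have h4 := mul_le_mul_of_nonneg_left h2 (show 0 ≤ 3 * N^m by positivity)
        linarith
    rw [Finset.sum_comm]
    calc _ = ∑ i, ∑ j, ∑ k, ∑ φ : Fin m → V, qf E (φ i) (φ j) (φ k) := by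
          refine Finset.sum_congr rfl fun i _ => ?_
          rw [Finset.sum_comm]
          refine Finset.sum_congr rfl fun j _ => ?_
          rw [Finset.sum_comm]
      _ ≤ ∑ i : Fin m, ∑ j : Fin m, ∑ k : Fin m, (N^m * (Qf E / N^3) +
            3 * N^m * ((if i = j then (1:ℝ) else 0) + (if i = k then 1 else 0)
          + (if j = k then 1 else 0))) :=
          Finset.sum_le_sum fun i _ => Finset.sum_le_sum fun j _ => Finset.sum_le_sum fun k _ =>
            hb i j k
      _ = _ := by
          have hs := sum_eq_ind m
          have hs2 : ∑ i : Fin m, ∑ j : Fin m, ∑ k : Fin m, 3 * N^m * ((if i = j then (1:ℝ) else 0)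
              + (if i = k then 1 else 0) + (if j = k then 1 else 0)) = 3 * N^m * (3 * (m:ℝ)^2) := by
            rw [← hs]
            simp only [Finset.mul_sum]
          have hs3 : ∀ (c : ℝ) (f : Fin m → Fin m → Fin m → ℝ),
              ∑ i, ∑ j, ∑ k, (c + f i j k)
                = (∑ i : Fin m, ∑ j : Fin m, ∑ k : Fin m, c) + ∑ i, ∑ j, ∑ k, f i j k := by
            intro c f
            simp only [Finset.sum_add_distrib]
          rw [hs3, hs2]
          simp only [Finset.sum_const, Finset.card_univ, Fintype.card_fin, nsmul_eq_mul]; ring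
  have hP : 0 < N^m := by positivity
  have hm : 0 ≤ 4/9 * (m:ℝ)^3 := by positivity
  have hl : 4/9 * (m:ℝ)^3 * (N^m - N^m * ((m:ℝ)^3 * (B3 E / N^3)) - N^m * ((m:ℝ)^4 * (B4 E / N^4)))
      ≤ N^m * ((m:ℝ)^3 * (Qf E / N^3) + 9 * (m:ℝ)^2) :=
    (mul_le_mul_of_nonneg_left (by linarith) hm).trans (hsum.trans hq)
  refine le_of_mul_le_mul_left ?_ hP
  calc _ = 4/9 * (m:ℝ)^3 * (N^m - N^m * ((m:ℝ)^3 * (B3 E / N^3))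
        - N^m * ((m:ℝ)^4 * (B4 E / N^4))) := by ring
    _ ≤ _ := hl

end sampling

section counting
open Classical

theorem sum3_card {V : Type*} [Fintype V] (P : V → V → V → Prop) :
    ∑ u, ∑ v, ∑ w, (if P u v w then (1:ℝ) else 0)
      = ((Finset.univ.filter (fun t : V × V × V => P t.1 t.2.1 t.2.2)).card : ℝ) := by
  rw [Finset.card_filter]
  push_cast
  rw [Fintype.sum_prod_type]
  refine Finset.sum_congr rfl fun u _ => ?_
  rw [Fintype.sum_prod_type]

theorem sum4_card {V : Type*} [Fintype V] (P : V → V → V → V → Prop) :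
    ∑ u, ∑ v, ∑ w, ∑ z, (if P u v w z then (1:ℝ) else 0)
      = ((Finset.univ.filter
          (fun t : V × V × V × V => P t.1 t.2.1 t.2.2.1 t.2.2.2)).card : ℝ) := by
  rw [Finset.card_filter]
  push_cast
  rw [Fintype.sum_prod_type]
  refine Finset.sum_congr rfl fun u _ => ?_
  rw [Fintype.sum_prod_type]
  refine Finset.sum_congr rfl fun v _ => ?_
  rw [Fintype.sum_prod_type]

theorem B3_le {V : Type*} [Fintype V] (E : V → V → Prop) (hor : IsOrgraph E) :
    B3 E ≤ 27 * (p3barCount V E : ℝ) := by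
  unfold B3 p3barCount
  rw [sum3_card]
  norm_cast
  refine Finset.card_le_mul_card_image_of_maps_to
    (f := fun t : V × V × V => ({t.1, t.2.2, t.2.1} : Finset V)) ?_ 27 ?_
  · rintro ⟨u, v, w⟩ h
    simp only [Finset.mem_filter, Finset.mem_univ, true_and] at h
    obtain ⟨d1, d2, d3⟩ := bad3_ne hor h
    obtain ⟨h1, h2, h3, h4, h5⟩ := h
    simp only [Finset.mem_filter, Finset.mem_powersetCard, Finset.subset_univ, true_and]
    exact ⟨Finset.card_eq_three.2 ⟨u, w, v, d2, d1, d3.symm, rfl⟩,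
      u, w, v, d2, d1, d3.symm, rfl, h5, by tauto, by tauto⟩
  · intro s hs
    simp only [Finset.mem_filter, Finset.mem_powersetCard] at hs
    calc _ ≤ (s ×ˢ s ×ˢ s).card := by
          apply Finset.card_le_card
          rintro ⟨u, v, w⟩ h
          simp only [Finset.mem_filter] at h
          rw [← h.2]
          simp
      _ = 27 := by simp [Finset.card_product, hs.1.2]

theorem B4_le {V : Type*} [Fintype V] (E : V → V → Prop) :
    B4 E ≤ 256 * (c4Count V E : ℝ) := by
  unfold B4 c4Count
  rw [sum4_card]
  norm_cast
  refine Finset.card_le_mul_card_image_of_maps_to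
    (f := fun t : V × V × V × V => ({t.1, t.2.1, t.2.2.1, t.2.2.2} : Finset V)) ?_ 256 ?_
  · rintro ⟨u, v, w, z⟩ h
    simp only [Finset.mem_filter, Finset.mem_univ, true_and] at h
    obtain ⟨d1, d2, d3, d4, d5, d6, h⟩ := h
    simp only [Finset.mem_filter, Finset.mem_powersetCard, Finset.subset_univ, true_and]
    refine ⟨?_, u, v, w, z, d1, d2, d3, d4, d5, d6, rfl, h⟩
    simp [Finset.card_insert_of_notMem, d1, d2, d3, d4, d5, d6]
  · intro s hs
    simp only [Finset.mem_filter, Finset.mem_powersetCard] at hs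
    calc _ ≤ (s ×ˢ s ×ˢ s ×ˢ s).card := by
          apply Finset.card_le_card
          rintro ⟨u, v, w, z⟩ h
          simp only [Finset.mem_filter] at h
          rw [← h.2]
          simp
      _ = 256 := by simp [Finset.card_product, hs.1.2]

/-- distinct ordered FDF triple -/
def fdf3 {V : Type*} (E : V → V → Prop) (u v w : V) : Prop :=
  u ≠ v ∧ u ≠ w ∧ v ≠ w ∧ FDFedge E u v w

theorem fdf3_le {V : Type*} [Fintype V] (E : V → V → Prop) :
    ∑ u, ∑ v, ∑ w, (if fdf3 E u v w then (1:ℝ) else 0) ≤ 6 * (fdfCount V E : ℝ) := by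
  unfold fdfCount
  rw [sum3_card]
  norm_cast
  refine Finset.card_le_mul_card_image_of_maps_to
    (f := fun t : V × V × V => ({t.1, t.2.1, t.2.2} : Finset V)) ?_ 6 ?_
  · rintro ⟨u, v, w⟩ h
    simp only [Finset.mem_filter, Finset.mem_univ, true_and] at h
    obtain ⟨d1, d2, d3, h⟩ := h
    simp only [Finset.mem_filter, Finset.mem_powersetCard, Finset.subset_univ, true_and]
    exact ⟨Finset.card_eq_three.2 ⟨u, v, w, d1, d2, d3, rfl⟩,
      u, v, w, d1, d2, d3, rfl, h⟩
  · intro s hs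
    simp only [Finset.mem_filter] at hs
    obtain ⟨-, a, b, c, d1, d2, d3, hs, -⟩ := hs
    calc _ ≤ ({(a, b, c), (a, c, b), (b, a, c), (b, c, a), (c, a, b), (c, b, a)} :
            Finset (V × V × V)).card := by
          apply Finset.card_le_card
          rintro ⟨u, v, w⟩ h
          simp only [Finset.mem_filter, Finset.mem_univ, true_and] at h
          obtain ⟨⟨e1, e2, e3, -⟩, h⟩ := h
          have hu : u ∈ s := by rw [← h]; simp
          have hv : v ∈ s := by rw [← h]; simp
          have hw : w ∈ s := by rw [← h]; simp
          rw [hs] at hu hv hw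
          simp only [Finset.mem_insert, Finset.mem_singleton] at hu hv hw
          simp only [Finset.mem_insert, Finset.mem_singleton, Prod.mk.injEq]
          rcases hu with rfl | rfl | rfl <;> rcases hv with rfl | rfl | rfl <;>
            rcases hw with rfl | rfl | rfl <;> simp_all
      _ ≤ 6 := Finset.card_le_six

theorem Qf_le {V : Type*} [Fintype V] (E : V → V → Prop) (hor : IsOrgraph E) :
    Qf E ≤ 6 * (fdfCount V E : ℝ) + 3 * (Fintype.card V : ℝ)^2 := by
  have key : Qf E = ∑ u, ∑ v, ∑ w, ((if E u v ∧ E u w then (1:ℝ) else 0)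
      + (if E v u ∧ E v w then (1:ℝ) else 0) + (if E w u ∧ E w v then (1:ℝ) else 0)
      + (if (¬ E u v ∧ ¬ E v u) ∧ (¬ E u w ∧ ¬ E w u) then 1 else 0)) := by
    have e2 : ∑ u, ∑ v, ∑ w, (if E v u ∧ E v w then (1:ℝ) else 0)
        = ∑ u, ∑ v, ∑ w, (if E u v ∧ E u w then (1:ℝ) else 0) := Finset.sum_comm
    have e3 : ∑ u, ∑ v, ∑ w, (if E w u ∧ E w v then (1:ℝ) else 0)
        = ∑ u, ∑ v, ∑ w, (if E v u ∧ E v w then (1:ℝ) else 0) :=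
      Finset.sum_congr rfl fun u _ => Finset.sum_comm
    rw [Qf_eq]
    unfold qf
    simp only [Finset.sum_add_distrib, ← Finset.mul_sum]
    rw [e3, e2]
    ring
  have hpt : ∀ u v w, ((if E u v ∧ E u w then (1:ℝ) else 0)
      + (if E v u ∧ E v w then (1:ℝ) else 0) + (if E w u ∧ E w v then (1:ℝ) else 0)
      + (if (¬ E u v ∧ ¬ E v u) ∧ (¬ E u w ∧ ¬ E w u) then 1 else 0))
      ≤ (if fdf3 E u v w then (1:ℝ) else 0) + ((if u = v then (1:ℝ) else 0)
        + (if u = w then 1 else 0) + (if v = w then 1 else 0)) := by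
    intro u v w
    have hl := hor.1
    have ha := hor.2
    by_cases c1 : u = v
    · subst c1
      by_cases c2 : u = w
      · subst c2
        simp [hl, fdf3]
      · by_cases x : E u w <;> by_cases y : E w u
        · exact absurd y (ha _ _ x)
        all_goals simp [hl, fdf3, x, y, c2]
    by_cases c2 : u = w
    · subst c2
      have c1' : ¬ v = u := fun h => c1 h.symm
      by_cases x : E u v <;> by_cases y : E v u
      · exact absurd y (ha _ _ x)
      all_goals simp [hl, fdf3, x, y, c1, c1']
    by_cases c3 : v = w
    · subst c3
      by_cases x : E u v <;> by_cases y : E v u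
      · exact absurd y (ha _ _ x)
      all_goals simp [hl, fdf3, x, y, c1]
    have tri : ∀ x y, (E x y ∧ ¬ E y x) ∨ (¬ E x y ∧ E y x) ∨ (¬ E x y ∧ ¬ E y x) := by
      intro x y
      have := ha x y
      tauto
    simp only [fdf3, FDFedge, c1, c2, c3, if_false]
    rcases tri u v with ⟨x1, x2⟩ | ⟨x1, x2⟩ | ⟨x1, x2⟩ <;>
    rcases tri u w with ⟨x3, x4⟩ | ⟨x3, x4⟩ | ⟨x3, x4⟩ <;>
    rcases tri v w with ⟨x5, x6⟩ | ⟨x5, x6⟩ | ⟨x5, x6⟩ <;>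
    simp [x1, x2, x3, x4, x5, x6, c1, c2, c3]
  rw [key]
  calc _ ≤ ∑ u : V, ∑ v : V, ∑ w : V, ((if fdf3 E u v w then (1:ℝ) else 0)
        + ((if u = v then (1:ℝ) else 0)
        + (if u = w then 1 else 0) + (if v = w then 1 else 0))) :=
        Finset.sum_le_sum fun u _ => Finset.sum_le_sum fun v _ => Finset.sum_le_sum fun w _ =>
          hpt u v w
    _ = (∑ u, ∑ v, ∑ w, (if fdf3 E u v w then (1:ℝ) else 0)) + 3 * (Fintype.card V : ℝ)^2 := by
        simp only [Finset.sum_add_distrib]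
        congr 1
        simp
        ring
    _ ≤ _ := by linarith [fdf3_le E]

end counting

/-- Stability version for complete multipartite: an orgraph with at most
δ·C(n,4) induced C⃗₄'s and at most δ·C(n,3) induced P̄₃'s has at least
(4/9 − ε)·C(n,3) edges in FDF(Γ). -/
theorem stmt16 :
    ∀ ε : ℝ, ε > 0 → ∃ δ : ℝ, δ > 0 ∧ ∃ N : ℕ, ∀ n : ℕ, N ≤ n →
      ∀ E : Fin n → Fin n → Prop, IsOrgraph E →
        (c4Count (Fin n) E : ℝ) ≤ δ * (n.choose 4 : ℝ) →
        (p3barCount (Fin n) E : ℝ) ≤ δ * (n.choose 3 : ℝ) →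
        ((4 : ℝ) / 9 - ε) * (n.choose 3 : ℝ) ≤ (fdfCount (Fin n) E : ℝ) := by
  intro ε hε
  obtain ⟨m, hm⟩ := exists_nat_ge (27 / ε + 1)
  have hm1 : (1:ℝ) ≤ m := le_trans (by have : 0 < 27 / ε := by positivity
                                       linarith) hm
  have hm0 : (0:ℝ) < m := by linarith
  obtain ⟨N, hN⟩ := exists_nat_ge (9 / ε + 1)
  refine ⟨ε / (600 * (m:ℝ)^4), by positivity, N, ?_⟩
  intro n hn E hor h4 h3
  have hnR : 9 / ε + 1 ≤ (n:ℝ) := hN.trans (by exact_mod_cast hn)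
  have hn1 : (1:ℝ) ≤ n := le_trans (by have : 0 < 9 / ε := by positivity
                                       linarith) hnR
  have hn0 : (0:ℝ) < n := by linarith
  by_cases hbig : 4 / 9 ≤ ε
  · have h1 : ((4 : ℝ) / 9 - ε) * (n.choose 3 : ℝ) ≤ 0 :=
      mul_nonpos_of_nonpos_of_nonneg (by linarith) (by positivity)
    exact h1.trans (by positivity)
  push Not at hbig
  have hne : Nonempty (Fin n) := ⟨⟨0, by exact_mod_cast hn0⟩⟩
  obtain ⟨δ, hδ⟩ : ∃ δ, δ = ε / (600 * (m:ℝ)^4) := ⟨_, rfl⟩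
  rw [← hδ] at h3 h4
  have hδ0 : 0 < δ := by rw [hδ]; positivity
  have hδm : δ * (m:ℝ)^4 = ε / 600 := by rw [hδ]; field_simp
  have hc3 : (n.choose 3 : ℝ) ≤ (n:ℝ)^3 / 6 := by
    have := Nat.choose_le_pow_div (α := ℝ) 3 n
    norm_num [Nat.factorial] at this
    exact this
  have hc4 : (n.choose 4 : ℝ) ≤ (n:ℝ)^4 := by
    have := Nat.choose_le_pow_div (α := ℝ) 4 n
    norm_num [Nat.factorial] at this
    have h' : 0 ≤ (n:ℝ)^4 := by positivity
    linarith
  have hB3 : B3 E / (n:ℝ)^3 ≤ 27 * δ := by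
    rw [div_le_iff₀ (by positivity)]
    have h1 := B3_le E hor
    have h2 : δ * (n.choose 3 : ℝ) ≤ δ * (n:ℝ)^3 :=
      mul_le_mul_of_nonneg_left (hc3.trans (by
        have h' : 0 ≤ (n:ℝ)^3 := by positivity
        linarith)) hδ0.le
    linarith
  have hB4 : B4 E / (n:ℝ)^4 ≤ 256 * δ := by
    rw [div_le_iff₀ (by positivity)]
    have h1 := B4_le E
    have h2 : δ * (n.choose 4 : ℝ) ≤ δ * (n:ℝ)^4 := mul_le_mul_of_nonneg_left hc4 hδ0.le
    linarith
  have hs := sampling_bound E hor m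
  rw [Fintype.card_fin] at hs
  have hm34 : (m:ℝ)^3 ≤ (m:ℝ)^4 := pow_le_pow_right₀ hm1 (by norm_num)
  have t3 : (m:ℝ)^3 * (B3 E / (n:ℝ)^3) ≤ 27 * (ε / 600) := by
    calc _ ≤ (m:ℝ)^3 * (27 * δ) := mul_le_mul_of_nonneg_left hB3 (by positivity)
      _ ≤ (m:ℝ)^4 * (27 * δ) := mul_le_mul_of_nonneg_right hm34 (by positivity)
      _ = 27 * (δ * (m:ℝ)^4) := by ring
      _ = _ := by rw [hδm]
  have t4 : (m:ℝ)^4 * (B4 E / (n:ℝ)^4) ≤ 256 * (ε / 600) := by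
    calc _ ≤ (m:ℝ)^4 * (256 * δ) := mul_le_mul_of_nonneg_left hB4 (by positivity)
      _ = 256 * (δ * (m:ℝ)^4) := by ring
      _ = _ := by rw [hδm]
  have hq : 4/9 * (1 - ε / 2) - ε / 3 ≤ Qf E / (n:ℝ)^3 := by
    have h27 : 9 * (m:ℝ)^2 ≤ (m:ℝ)^3 * (ε / 3) := by
      have : 27 ≤ (m:ℝ) * ε := by
        rw [← div_le_iff₀ hε]; linarith
      calc 9 * (m:ℝ)^2 = (m:ℝ)^2 * (27 / 3) := by ring
        _ ≤ (m:ℝ)^2 * ((m:ℝ) * ε / 3) := by gcongr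
        _ = _ := by ring
    have h5 : 4/9 * (m:ℝ)^3 * (1 - ε / 2) ≤ (m:ℝ)^3 * (Qf E / (n:ℝ)^3) + 9 * (m:ℝ)^2 :=
      (mul_le_mul_of_nonneg_left (by linarith) (by positivity)).trans hs
    have hp : 0 < (m:ℝ)^3 := by positivity
    refine le_of_mul_le_mul_left ?_ hp
    linarith
  rw [le_div_iff₀ (by positivity)] at hq
  have hQ := Qf_le E hor
  rw [Fintype.card_fin] at hQ
  have h9 : 3 * (n:ℝ)^2 ≤ (n:ℝ)^3 * (ε / 3) := by
    have : 9 ≤ (n:ℝ) * ε := by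
      rw [← div_le_iff₀ hε]; linarith
    calc 3 * (n:ℝ)^2 = (n:ℝ)^2 * (9 / 3) := by ring
      _ ≤ (n:ℝ)^2 * ((n:ℝ) * ε / 3) := by gcongr
      _ = _ := by ring
  have hfin : ((4:ℝ)/9 - ε) * ((n:ℝ)^3 / 6) ≤ fdfCount (Fin n) E := by
    have hp : 0 < (n:ℝ)^3 * ε := by positivity
    nlinarith
  exact (mul_le_mul_of_nonneg_left hc3 (by linarith)).trans hfin
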